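/- Let A be a graph cycle with A ≠ S and let ε > 0. Then for every x ∈ A, the probability ℙ_x[ exp(β(H_e(A)+ε)) > τ_{∂A} > exp(β(H_e(A)−ε)) ] tends to 1 as β → ∞. -/

import Mathlib

open scoped ENNReal

namespace MetropolisCycles

variable {S : Type*} [Fintype S] [DecidableEq S]

/-- A path: a finite sequence of states whose consecutive members communicate. -/
def IsPath (q : S → S → ℝ) (ω : List S) : Prop :=
  ω.Chain' (fun a b => 0 < q a b)

/-- `x` and `y` are joined by a path entirely contained in `G`. -/
def JoinedIn (q : S → S → ℝ) (G : Set S) (x y : S) : Prop :=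
  ∃ ω : List S, ω.head? = some x ∧ ω.getLast? = some y ∧ IsPath q ω ∧ ∀ z ∈ ω, z ∈ G

/-- `G` is connected: any two of its points are joined by a path inside `G`. -/
def IsConnectedSet (q : S → S → ℝ) (G : Set S) : Prop :=
  ∀ x ∈ G, ∀ y ∈ G, JoinedIn q G x y

/-- The exterior boundary `∂G`. -/
def extBoundary (q : S → S → ℝ) (G : Set S) : Set S :=
  {y | y ∉ G ∧ ∃ x ∈ G, 0 < q x y}

/-- `A` is a non-trivial path cycle: connected and `max_A H < min_{∂A} H`. -/
def IsNontrivialPathCycle (H : S → ℝ) (q : S → S → ℝ) (A : Set S) : Prop :=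
  A.Nonempty ∧ IsConnectedSet q A ∧ ∀ x ∈ A, ∀ y ∈ extBoundary q A, H x < H y

/-- `A` is a path cycle: a singleton or a non-trivial path cycle. -/
def IsPathCycle (H : S → ℝ) (q : S → S → ℝ) (A : Set S) : Prop :=
  (∃ x, A = {x}) ∨ IsNontrivialPathCycle H q A

/-- The set of points joined to `x` by a path whose points all have energy at most `c`. -/
def energyCut (H : S → ℝ) (q : S → S → ℝ) (c : ℝ) (x : S) : Set S :=
  {y | JoinedIn q {z | H z ≤ c} x y}

/-- `U_{≤ x}`: the points joined to `x` by a path with energies at most `H x`. -/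
def Ule (H : S → ℝ) (q : S → S → ℝ) (x : S) : Set S := energyCut H q (H x) x

/-- The Metropolis transition kernel `p_β`. -/
noncomputable def pMet (H : S → ℝ) (q : S → S → ℝ) (β : ℝ) (x y : S) : ℝ :=
  if x = y then 1 - ∑ z ∈ Finset.univ.erase x, q x z * Real.exp (-(β * max (H z - H x) 0))
  else q x y * Real.exp (-(β * max (H y - H x) 0))

/-- The trajectory started at `x` whose `n` first steps are given by `f`
(frozen after time `n`). -/
def trajFun (x : S) {n : ℕ} (f : Fin n → S) : ℕ → S := fun t =>
  if h : min t n = 0 then x else f ⟨min t n - 1, by omega⟩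

/-- The probability weight of the finite trajectory `x, f 0, …, f (n-1)`. -/
noncomputable def trajWeight (H : S → ℝ) (q : S → S → ℝ) (β : ℝ) (x : S) {n : ℕ}
    (f : Fin n → S) : ℝ :=
  ∏ t ∈ Finset.range n, pMet H q β (trajFun x f t) (trajFun x f (t + 1))

open scoped Classical in
/-- `ℙ_x[Ev]` for an event `Ev` determined by the trajectory up to time `n`. -/
noncomputable def ProbX (H : S → ℝ) (q : S → S → ℝ) (β : ℝ) (x : S) (n : ℕ)
    (Ev : (ℕ → S) → Prop) : ℝ :=
  ∑ f : Fin n → S, if Ev (trajFun x f) then trajWeight H q β x f else 0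

/-- The hitting time `τ_G` of `G`, with value `⊤` if `G` is never visited. -/
noncomputable def hitTime (G : Set S) (ω : ℕ → S) : ℕ∞ :=
  ⨅ t ∈ {t : ℕ | ω t ∈ G}, (t : ℕ∞)

/-- The depth `Γ(A) = min_{∂A} H - min_A H` of a cycle. -/
noncomputable def cycleDepth (H : S → ℝ) (q : S → S → ℝ) (A : Set S) : ℝ :=
  sInf (H '' extBoundary q A) - sInf (H '' A)

/-- The resistance height `Γ̃(A) = max_A H - min_A H` of a cycle. -/
noncomputable def cycleRes (H : S → ℝ) (A : Set S) : ℝ :=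
  sSup (H '' A) - sInf (H '' A)

/-- The total cost of a path of cycles with respect to a cost function `Vs`. -/
noncomputable def listCost (Vs : Set S → Set S → ℝ≥0∞) : List (Set S) → ℝ≥0∞
  | [] => 0
  | [_] => 0
  | B :: B' :: l => Vs B B' + listCost Vs (B' :: l)

/-- `H_e` relative to a level `(E, V)` of the construction:
`H_e(A) = min { V(A,A') : A' ∈ E, A' ≠ A }`. -/
noncomputable def HeAux (E : Set (Set S)) (V : Set S → Set S → ℝ≥0∞) (A : Set S) : ℝ≥0∞ :=
  ⨅ A' ∈ E \ {A}, V A A'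

/-- The renormalized cost function `V_* (A,B) = V(A,B) - H_e(A)`. -/
noncomputable def VsAux (E : Set (Set S)) (V : Set S → Set S → ℝ≥0∞) (A B : Set S) : ℝ≥0∞ :=
  V A B - HeAux E V A

/-- `A →_k A'`: some path of elements of `E` from `A` to `A'` has zero total `V_*`-cost. -/
def arrowAux (E : Set (Set S)) (V : Set S → Set S → ℝ≥0∞) (A A' : Set S) : Prop :=
  ∃ l : List (Set S), l.head? = some A ∧ l.getLast? = some A' ∧ (∀ B ∈ l, B ∈ E) ∧
    listCost (VsAux E V) l = 0

/-- The set `D^{k+1}`: unions of the `R_k`-equivalence classes. -/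
def DAux (E : Set (Set S)) (V : Set S → Set S → ℝ≥0∞) : Set (Set S) :=
  {B | ∃ A ∈ E, B = ⋃₀ {A' | A' ∈ E ∧ arrowAux E V A A' ∧ arrowAux E V A' A}}

/-- The order relation `≥^{k+1}` on `D^{k+1}`. -/
def geqAux (E : Set (Set S)) (V : Set S → Set S → ℝ≥0∞) (B B' : Set S) : Prop :=
  ∃ C ∈ E, ∃ C' ∈ E, C ⊆ B ∧ C' ⊆ B' ∧ arrowAux E V C C'

/-- `D_*^{k+1}`: the minimal elements of `D^{k+1}` for `≥^{k+1}`. -/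
def DstarAux (E : Set (Set S)) (V : Set S → Set S → ℝ≥0∞) : Set (Set S) :=
  {B ∈ DAux E V | ∀ B' ∈ DAux E V, geqAux E V B B' → B' = B}

/-- `E^{k+1}` built from `(E^k, V^k)`. -/
def EnextAux (E : Set (Set S)) (V : Set S → Set S → ℝ≥0∞) : Set (Set S) :=
  DstarAux E V ∪ {A | A ∈ E ∧ ∃ B ∈ DAux E V \ DstarAux E V, A ⊆ B}

/-- `H_m^{k+1}(A) = max { H_e^k(A') : A' ∈ E^k, A' ⊆ A }`. -/
noncomputable def HmAux (E : Set (Set S)) (V : Set S → Set S → ℝ≥0∞) (A : Set S) : ℝ≥0∞ :=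
  ⨆ A' ∈ {A' | A' ∈ E ∧ A' ⊆ A}, HeAux E V A'

/-- `V^{k+1}(A,A') = H_m^{k+1}(A) + min { V_*^k(B,B') : B,B' ∈ E^k, B ⊆ A, B' ⊆ A' }`. -/
noncomputable def VnextAux (E : Set (Set S)) (V : Set S → Set S → ℝ≥0∞) (A A' : Set S) : ℝ≥0∞ :=
  HmAux E V A + ⨅ B ∈ {B | B ∈ E ∧ B ⊆ A}, ⨅ B' ∈ {B' | B' ∈ E ∧ B' ⊆ A'}, VsAux E V B B'

/-- The zero-order cost function `V^0({i},{j}) = (H j - H i)⁺` if `q i j > 0`, `∞` otherwise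
(and `∞` on non-singletons). -/
noncomputable def V0 (H : S → ℝ) (q : S → S → ℝ) (A B : Set S) : ℝ≥0∞ :=
  ⨅ i ∈ A, ⨅ j ∈ B, ⨅ _ : A = {i} ∧ B = {j} ∧ 0 < q i j, ENNReal.ofReal (H j - H i)

/-- The recursive construction `k ↦ (E^k, V^k)`. -/
noncomputable def cycEV (H : S → ℝ) (q : S → S → ℝ) : ℕ → Set (Set S) × (Set S → Set S → ℝ≥0∞)
  | 0 => ({A | ∃ i, A = {i}}, V0 H q)
  | k + 1 => (EnextAux (cycEV H q k).1 (cycEV H q k).2,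
              VnextAux (cycEV H q k).1 (cycEV H q k).2)

/-- The `k`-th order set of graph cycles `E^k`. -/
noncomputable def Ecyc (H : S → ℝ) (q : S → S → ℝ) (k : ℕ) : Set (Set S) := (cycEV H q k).1

/-- The `k`-th order cost function `V^k`. -/
noncomputable def Vcyc (H : S → ℝ) (q : S → S → ℝ) (k : ℕ) : Set S → Set S → ℝ≥0∞ :=
  (cycEV H q k).2

/-- `H_e^k(A)`. -/
noncomputable def Hek (H : S → ℝ) (q : S → S → ℝ) (k : ℕ) (A : Set S) : ℝ≥0∞ :=
  HeAux (Ecyc H q k) (Vcyc H q k) A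

/-- `H_m^k(A)` (defined for `k ≥ 1`; set to `0` at `k = 0`). -/
noncomputable def Hmk (H : S → ℝ) (q : S → S → ℝ) : ℕ → Set S → ℝ≥0∞
  | 0 => fun _ => 0
  | k + 1 => fun A => HmAux (Ecyc H q k) (Vcyc H q k) A

/-- `D^{n+1}` (indexed by `n`). -/
noncomputable def Dcyc (H : S → ℝ) (q : S → S → ℝ) (n : ℕ) : Set (Set S) :=
  DAux (Ecyc H q n) (Vcyc H q n)

/-- `D_*^{n+1}` (indexed by `n`). -/
noncomputable def DstarCyc (H : S → ℝ) (q : S → S → ℝ) (n : ℕ) : Set (Set S) :=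
  DstarAux (Ecyc H q n) (Vcyc H q n)

/-- The set of graph cycles `C = ∪_k E^k`. -/
def GraphCycles (H : S → ℝ) (q : S → S → ℝ) : Set (Set S) := {A | ∃ k, A ∈ Ecyc H q k}

/-- `H_e(A) = sup { H_e^k(A) : k ≥ 0, A ∈ E^k }` (for a graph cycle `A ≠ S`). -/
noncomputable def HeC (H : S → ℝ) (q : S → S → ℝ) (A : Set S) : ℝ≥0∞ :=
  ⨆ k, ⨆ _ : A ∈ Ecyc H q k, Hek H q k A

/-- `H_m(A) = max( sup { H_e(B) : B ∈ C, B ⊆ A, B ≠ A }, 0 )` (for `|A| > 1`). -/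
noncomputable def HmC (H : S → ℝ) (q : S → S → ℝ) (A : Set S) : ℝ≥0∞ :=
  ⨆ B ∈ {B | B ∈ GraphCycles H q ∧ B ⊆ A ∧ B ≠ A}, HeC H q B

/-- The trajectory that starts at `x` and then follows `ω`. -/
def consTraj (x : S) (ω : ℕ → S) : ℕ → S
  | 0 => x
  | t + 1 => ω t

omit [Fintype S] [DecidableEq S] in
theorem trajFun_zero (x : S) {n : ℕ} (f : Fin n → S) : trajFun x f 0 = x := by
  simp [trajFun]

omit [Fintype S] [DecidableEq S] in
theorem trajFun_cons (x y : S) {n : ℕ} (f : Fin n → S) :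
    trajFun x (Fin.cons y f : Fin (n + 1) → S) = consTraj x (trajFun y f) := by
  funext t
  rcases t with _ | t
  · simp [trajFun, consTraj]
  · simp only [consTraj, trajFun]
    have h : min (t + 1) (n + 1) = min t n + 1 := by omega
    rw [dif_neg (by omega)]
    split_ifs with h0
    · have : (⟨min (t + 1) (n + 1) - 1, by omega⟩ : Fin (n + 1)) = 0 := by
        ext; simp; omega
      rw [this, Fin.cons_zero]
    · have : (⟨min (t + 1) (n + 1) - 1, by omega⟩ : Fin (n + 1)) =
          Fin.succ ⟨min t n - 1, by omega⟩ := by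
        ext; simp; omega
      rw [this, Fin.cons_succ]

theorem trajWeight_cons (H : S → ℝ) (q : S → S → ℝ) (β : ℝ) (x y : S) {n : ℕ}
    (f : Fin n → S) :
    trajWeight H q β x (Fin.cons y f : Fin (n + 1) → S) =
      pMet H q β x y * trajWeight H q β y f := by
  unfold trajWeight
  rw [trajFun_cons, Finset.prod_range_succ', mul_comm]
  simp [consTraj, trajFun_zero]

theorem probX_succ (H : S → ℝ) (q : S → S → ℝ) (β : ℝ) (x : S) (n : ℕ)
    (Ev : (ℕ → S) → Prop) :
    ProbX H q β x (n + 1) Ev =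
      ∑ y, pMet H q β x y * ProbX H q β y n (fun ω => Ev (consTraj x ω)) := by
  classical
  unfold ProbX
  rw [← (Fin.consEquiv (fun _ : Fin (n + 1) => S)).sum_comp, Fintype.sum_prod_type]
  refine Finset.sum_congr rfl fun y _ => ?_
  rw [Finset.mul_sum]
  refine Finset.sum_congr rfl fun f _ => ?_
  have h1 : Fin.consEquiv (fun _ : Fin (n + 1) => S) (y, f) = Fin.cons y f := rfl
  simp only [h1, trajFun_cons, trajWeight_cons, mul_ite, mul_zero]

theorem sum_pMet (H : S → ℝ) (q : S → S → ℝ) (β : ℝ) (x : S) :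
    ∑ y, pMet H q β x y = 1 := by
  rw [← Finset.add_sum_erase _ _ (Finset.mem_univ x)]
  have : ∑ y ∈ Finset.univ.erase x, pMet H q β x y =
      ∑ z ∈ Finset.univ.erase x, q x z * Real.exp (-(β * max (H z - H x) 0)) := by
    refine Finset.sum_congr rfl fun y hy => ?_
    rw [pMet, if_neg (Finset.ne_of_mem_erase hy).symm]
  rw [this, pMet, if_pos rfl]
  ring

theorem pMet_nonneg {H : S → ℝ} {q : S → S → ℝ} (hq : ∀ x y, 0 ≤ q x y)
    (hsum : ∀ x : S, ∑ y ∈ Finset.univ.erase x, q x y ≤ 1) {β : ℝ} (hβ : 0 ≤ β) (x y : S) :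
    0 ≤ pMet H q β x y := by
  unfold pMet
  split_ifs
  · rw [sub_nonneg]
    refine le_trans (Finset.sum_le_sum fun z _ => ?_) (hsum x)
    refine mul_le_of_le_one_right (hq x z) (Real.exp_le_one_iff.2 ?_)
    have := mul_nonneg hβ (le_max_right (H z - H x) 0)
    linarith
  · exact mul_nonneg (hq x y) (Real.exp_nonneg _)

theorem probX_true (H : S → ℝ) (q : S → S → ℝ) (β : ℝ) (x : S) (n : ℕ) :
    ProbX H q β x n (fun _ => True) = 1 := by
  induction n generalizing x with
  | zero => simp [ProbX, trajWeight]
  | succ n ih => rw [probX_succ]; simp [ih, sum_pMet]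

theorem probX_congr {H : S → ℝ} {q : S → S → ℝ} {β : ℝ} {x : S} {n : ℕ}
    {Ev Ev' : (ℕ → S) → Prop} (h : ∀ ω, ω 0 = x → (Ev ω ↔ Ev' ω)) :
    ProbX H q β x n Ev = ProbX H q β x n Ev' := by
  unfold ProbX
  refine Finset.sum_congr rfl fun f _ => ?_
  have := h (trajFun x f) (trajFun_zero x f)
  by_cases h1 : Ev (trajFun x f) <;> simp_all

theorem probX_eq_zero {H : S → ℝ} {q : S → S → ℝ} {β : ℝ} {x : S} {n : ℕ}
    {Ev : (ℕ → S) → Prop} (h : ∀ ω, ω 0 = x → ¬ Ev ω) : ProbX H q β x n Ev = 0 := by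
  unfold ProbX
  exact Finset.sum_eq_zero fun f _ => if_neg (h _ (trajFun_zero x f))

theorem probX_and_not {H : S → ℝ} {q : S → S → ℝ} {β : ℝ} {x : S} {n : ℕ}
    {Ev Ev' : (ℕ → S) → Prop} (h : ∀ ω, Ev' ω → Ev ω) :
    ProbX H q β x n (fun ω => Ev ω ∧ ¬ Ev' ω) = ProbX H q β x n Ev - ProbX H q β x n Ev' := by
  unfold ProbX
  rw [← Finset.sum_sub_distrib]
  refine Finset.sum_congr rfl fun f _ => ?_
  have := h (trajFun x f)
  by_cases h1 : Ev (trajFun x f) <;> by_cases h2 : Ev' (trajFun x f) <;> simp_all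

/-- The probability that the chain with kernel `P` started at `x` stays in `A` up to time `n`. -/
noncomputable def surv (P : S → S → ℝ) (A : Set S) : ℕ → S → ℝ
  | 0 => A.indicator (fun _ => 1)
  | n + 1 => A.indicator (fun x => ∑ y, P x y * surv P A n y)

omit [DecidableEq S] in
theorem surv_of_notMem (P : S → S → ℝ) {A : Set S} {x : S} (hx : x ∉ A) (n : ℕ) :
    surv P A n x = 0 := by
  cases n <;> simp [surv, hx]

omit [DecidableEq S] in
theorem surv_succ (P : S → S → ℝ) {A : Set S} {x : S} (hx : x ∈ A) (n : ℕ) :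
    surv P A (n + 1) x = ∑ y, P x y * surv P A n y := by
  simp [surv, hx]

omit [DecidableEq S] in
theorem surv_zero (P : S → S → ℝ) {A : Set S} {x : S} (hx : x ∈ A) : surv P A 0 x = 1 := by
  simp [surv, hx]

theorem probX_avoid {H : S → ℝ} {q : S → S → ℝ} (hq : ∀ x y, 0 ≤ q x y) (β : ℝ) (A : Set S)
    {n N : ℕ} (hn : n ≤ N) {x : S} (hx : x ∈ A) :
    ProbX H q β x N (fun ω => ∀ t ≤ n, ω t ∉ extBoundary q A) = surv (pMet H q β) A n x := by
  have hxb : x ∉ extBoundary q A := fun h => h.1 hx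
  induction N generalizing n x with
  | zero =>
    obtain rfl : n = 0 := by omega
    rw [probX_congr (Ev' := fun _ => True), probX_true, surv_zero _ hx]
    intro ω h
    simp [h, hxb]
  | succ N ih =>
    rcases n with _ | n
    · rw [probX_congr (Ev' := fun _ => True), probX_true, surv_zero _ hx]
      intro ω h
      simp [h, hxb]
    · rw [probX_succ, surv_succ _ hx]
      refine Finset.sum_congr rfl fun y _ => ?_
      have hev : ∀ ω, (∀ t ≤ n + 1, consTraj x ω t ∉ extBoundary q A) ↔
          ∀ t ≤ n, ω t ∉ extBoundary q A := by
        refine fun ω => ⟨fun h t ht => h (t + 1) (by omega), fun h t ht => ?_⟩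
        rcases t with _ | t
        · exact hxb
        · exact h t (by omega)
      simp only [hev]
      by_cases hy : y ∈ A
      · rw [ih (by omega) hy fun h => h.1 hy]
      · rw [surv_of_notMem _ hy, mul_zero]
        by_cases hxy : 0 < q x y
        · rw [probX_eq_zero, mul_zero]
          exact fun ω h0 h => h 0 (Nat.zero_le _) (h0 ▸ ⟨hy, x, hx, hxy⟩)
        · have hne : x ≠ y := fun h => hy (h ▸ hx)
          have : q x y = 0 := le_antisymm (not_lt.1 hxy) (hq x y)
          rw [pMet, if_neg hne, this, zero_mul, zero_mul]

omit [Fintype S] [DecidableEq S] in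
theorem hitTime_eq_coe_iff {G : Set S} {ω : ℕ → S} {t : ℕ} :
    hitTime G ω = t ↔ ω t ∈ G ∧ ∀ s < t, ω s ∉ G := by
  classical
  have key : ∀ t : ℕ, ω t ∈ G → (∀ s < t, ω s ∉ G) → hitTime G ω = t := by
    intro t h1 h2
    refine le_antisymm (iInf₂_le t h1) (le_iInf₂ fun s hs => ?_)
    exact_mod_cast not_lt.1 fun hlt => h2 s hlt hs
  refine ⟨fun h => ?_, fun h => key t h.1 h.2⟩
  by_cases hex : ∃ s, ω s ∈ G
  · have h1 := key (Nat.find hex) (Nat.find_spec hex) fun s hs => Nat.find_min hex hs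
    have h2 : Nat.find hex = t := by exact_mod_cast h1.symm.trans h
    rw [← h2]
    exact ⟨Nat.find_spec hex, fun s hs => Nat.find_min hex hs⟩
  · push Not at hex
    have : hitTime G ω = ⊤ := by simp [hitTime, hex]
    rw [this] at h
    exact absurd h (by simp)

omit [Fintype S] [DecidableEq S] in
theorem hitTime_between_iff {G : Set S} {ω : ℕ → S} {a b : ℝ} (hb : 0 ≤ b) (ha : 0 < a) :
    ((∃ t : ℕ, hitTime G ω = t ∧ (t : ℝ) < a) ∧ ∀ t : ℕ, hitTime G ω = t → b < t) ↔
      (∀ t ≤ ⌊b⌋₊, ω t ∉ G) ∧ ¬ ∀ t ≤ ⌈a⌉₊ - 1, ω t ∉ G := by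
  classical
  have hN : 0 < ⌈a⌉₊ := Nat.ceil_pos.2 ha
  constructor
  · rintro ⟨⟨t, ht, hta⟩, h⟩
    have h1 := (Nat.floor_lt hb).2 (h t ht)
    have h2 := Nat.lt_ceil.2 hta
    obtain ⟨h3, h4⟩ := hitTime_eq_coe_iff.1 ht
    exact ⟨fun s hs => h4 s (by omega), fun h5 => h5 t (by omega) h3⟩
  · rintro ⟨h1, h2⟩
    push Not at h2
    obtain ⟨s, hs, hsG⟩ := h2
    have hex : ∃ s, ω s ∈ G := ⟨s, hsG⟩
    have hle : Nat.find hex ≤ s := Nat.find_min' hex hsG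
    refine ⟨⟨Nat.find hex, hitTime_eq_coe_iff.2
      ⟨Nat.find_spec hex, fun s hs => Nat.find_min hex hs⟩, Nat.lt_ceil.1 (by omega)⟩, ?_⟩
    intro t ht
    refine (Nat.floor_lt hb).1 (not_le.1 fun hle => h1 t hle (hitTime_eq_coe_iff.1 ht).1)

theorem probX_exit_window {H : S → ℝ} {q : S → S → ℝ} (hq : ∀ x y, 0 ≤ q x y) (β : ℝ)
    {A : Set S} {x : S} (hx : x ∈ A) {a b : ℝ} (hb : 0 ≤ b) (hba : b < a) :
    ProbX H q β x ⌈a⌉₊ (fun ω =>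
      (∃ t : ℕ, hitTime (extBoundary q A) ω = t ∧ (t : ℝ) < a) ∧
        ∀ t : ℕ, hitTime (extBoundary q A) ω = t → b < t) =
      surv (pMet H q β) A ⌊b⌋₊ x - surv (pMet H q β) A (⌈a⌉₊ - 1) x := by
  have ha : 0 < a := hb.trans_lt hba
  have hlt : ⌊b⌋₊ < ⌈a⌉₊ := (Nat.floor_lt hb).2 (hba.trans_le (Nat.le_ceil a))
  rw [probX_congr fun ω _ => hitTime_between_iff hb ha, probX_and_not,
    probX_avoid hq β A hlt.le hx, probX_avoid hq β A (Nat.sub_le _ _) hx]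
  exact fun ω h t ht => h t (by omega)

omit [DecidableEq S] in
theorem surv_nonneg {P : S → S → ℝ} (hP : ∀ x y, 0 ≤ P x y) (A : Set S) (n : ℕ) (x : S) :
    0 ≤ surv P A n x := by
  induction n generalizing x with
  | zero => exact Set.indicator_nonneg (fun _ _ => zero_le_one) x
  | succ n ih =>
    exact Set.indicator_nonneg (fun x _ => Finset.sum_nonneg fun y _ => mul_nonneg (hP x y) (ih y)) x

omit [DecidableEq S] in
theorem surv_le_one {P : S → S → ℝ} (hP : ∀ x y, 0 ≤ P x y) (hP1 : ∀ x, ∑ y, P x y = 1)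
    (A : Set S) (n : ℕ) (x : S) : surv P A n x ≤ 1 := by
  by_cases hx : x ∈ A
  · induction n generalizing x with
    | zero => rw [surv_zero P hx]
    | succ n ih =>
      rw [surv_succ P hx, ← hP1 x]
      refine Finset.sum_le_sum fun y _ => mul_le_of_le_one_right (hP x y) ?_
      by_cases hy : y ∈ A
      · exact ih y hy
      · rw [surv_of_notMem P hy]; exact zero_le_one
  · rw [surv_of_notMem P hx]; exact zero_le_one

omit [DecidableEq S] in
theorem surv_antitone {P : S → S → ℝ} (hP : ∀ x y, 0 ≤ P x y) (hP1 : ∀ x, ∑ y, P x y = 1)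
    (A : Set S) (x : S) : Antitone fun n => surv P A n x := by
  refine antitone_nat_of_succ_le fun n => ?_
  induction n generalizing x with
  | zero =>
    by_cases hx : x ∈ A
    · rw [surv_zero P hx]; exact surv_le_one hP hP1 A _ x
    · simp [surv_of_notMem P hx]
  | succ n ih =>
    by_cases hx : x ∈ A
    · rw [surv_succ P hx, surv_succ P hx]
      exact Finset.sum_le_sum fun y _ => mul_le_mul_of_nonneg_left (ih y) (hP x y)
    · simp [surv_of_notMem P hx]

/-- The Dirichlet form `⟨f, (1 - P) f⟩_μ`. -/
def energy (P : S → S → ℝ) (μ : S → ℝ) (f : S → ℝ) : ℝ :=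
  ∑ u, μ u * (f u * (f u - ∑ v, P u v * f v))

omit [DecidableEq S] in
theorem conductance_mul_sq_le_energy {P : S → S → ℝ} {μ : S → ℝ} (hP : ∀ x y, 0 ≤ P x y)
    (hP1 : ∀ x, ∑ y, P x y = 1) (hμ : ∀ x, 0 ≤ μ x)
    (hrev : ∀ x y, μ x * P x y = μ y * P y x) (f : S → ℝ) (u v : S) :
    μ u * P u v * (f u - f v) ^ 2 ≤ 2 * energy P μ f := by
  have hnn : ∀ u v, 0 ≤ μ u * P u v * (f u - f v) ^ 2 := fun u v =>
    mul_nonneg (mul_nonneg (hμ u) (hP u v)) (sq_nonneg _)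
  have h1 : ∑ u, ∑ v, μ u * P u v * (f u - f v) ^ 2 = 2 * energy P μ f := by
    have e1 : ∀ u, ∑ v, μ u * P u v * f u ^ 2 = μ u * f u ^ 2 := fun u => by
      calc ∑ v, μ u * P u v * f u ^ 2 = (μ u * f u ^ 2) * ∑ v, P u v := by
            rw [Finset.mul_sum]; exact Finset.sum_congr rfl fun v _ => by ring
        _ = _ := by rw [hP1, mul_one]
    have e2 : ∑ u, ∑ v, μ u * P u v * f v ^ 2 = ∑ u, μ u * f u ^ 2 := by
      rw [Finset.sum_comm]
      refine Finset.sum_congr rfl fun v _ => ?_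
      rw [← e1 v]
      exact Finset.sum_congr rfl fun u _ => by rw [hrev u v]
    have e3 : energy P μ f = ∑ u, μ u * f u ^ 2 - ∑ u, ∑ v, μ u * P u v * (f u * f v) := by
      rw [energy, ← Finset.sum_sub_distrib]
      refine Finset.sum_congr rfl fun u _ => ?_
      rw [mul_sub, mul_sub, Finset.mul_sum, Finset.mul_sum]
      congr 1
      · ring
      · exact Finset.sum_congr rfl fun v _ => by ring
    have e4 : ∑ u, ∑ v, μ u * P u v * (f u - f v) ^ 2 =
        ∑ u, ∑ v, μ u * P u v * f u ^ 2 + ∑ u, ∑ v, μ u * P u v * f v ^ 2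
          - 2 * ∑ u, ∑ v, μ u * P u v * (f u * f v) := by
      simp only [Finset.mul_sum, ← Finset.sum_add_distrib, ← Finset.sum_sub_distrib]
      exact Finset.sum_congr rfl fun u _ => Finset.sum_congr rfl fun v _ => by ring
    rw [e4, e2, e3, Finset.sum_congr rfl fun u _ => e1 u]
    ring
  rw [← h1]
  exact (Finset.single_le_sum (fun v _ => hnn u v) (Finset.mem_univ v)).trans
    (Finset.single_le_sum (f := fun u => ∑ v, μ u * P u v * (f u - f v) ^ 2)
      (fun u _ => Finset.sum_nonneg fun v _ => hnn u v) (Finset.mem_univ u))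

omit [Fintype S] [DecidableEq S] in
theorem exists_oscillation_bound [Finite S] (R : S → S → Prop) :
    ∃ K : ℝ, 0 ≤ K ∧ ∀ z y, Relation.ReflTransGen R z y → ∀ (f : S → ℝ) (D : ℝ), 0 ≤ D →
      (∀ u v, R u v → |f u - f v| ≤ D) → |f z - f y| ≤ K * D := by
  have h : ∀ z y, ∃ K : ℝ, Relation.ReflTransGen R z y → ∀ (f : S → ℝ) (D : ℝ), 0 ≤ D →
      (∀ u v, R u v → |f u - f v| ≤ D) → |f z - f y| ≤ K * D := by
    intro z y
    by_cases hzy : Relation.ReflTransGen R z y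
    · suffices ∃ K : ℝ, ∀ (f : S → ℝ) (D : ℝ), 0 ≤ D →
          (∀ u v, R u v → |f u - f v| ≤ D) → |f z - f y| ≤ K * D from this.imp fun _ hK _ => hK
      induction hzy with
      | refl => exact ⟨0, fun f D _ _ => by simp⟩
      | @tail b c _ hbc ih =>
        obtain ⟨K, hK⟩ := ih
        refine ⟨K + 1, fun f D hD hf => ?_⟩
        have h1 := abs_sub_le (f z) (f b) (f c)
        linarith [hK f D hD hf, hf b c hbc]
    · exact ⟨0, fun h => absurd h hzy⟩
  choose K hK using h
  obtain ⟨M, hM⟩ := (Set.finite_range fun p : S × S => K p.1 p.2).bddAbove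
  refine ⟨max M 0, le_max_right _ _, fun z y hzy f D hD hf => (hK z y hzy f D hD hf).trans ?_⟩
  exact mul_le_mul_of_nonneg_right ((hM ⟨(z, y), rfl⟩).trans (le_max_left _ _)) hD

/-- `u` and `v` communicate and both have energy at most `l`. -/
def EdgeBelow (H : S → ℝ) (q : S → S → ℝ) (l : ℝ) (u v : S) : Prop :=
  0 < q u v ∧ H u ≤ l ∧ H v ≤ l

omit [Fintype S] [DecidableEq S] in
theorem exists_pos_le_connectivity [Finite S] (q : S → S → ℝ) :
    ∃ r > 0, ∀ u v, 0 < q u v → r ≤ q u v := by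
  have hfin : ({p : S × S | 0 < q p.1 p.2}).Finite := Set.toFinite _
  rcases ({p : S × S | 0 < q p.1 p.2}).eq_empty_or_nonempty with h | h
  · refine ⟨1, one_pos, fun u v huv => ?_⟩
    have : (u, v) ∈ ({p : S × S | 0 < q p.1 p.2}) := huv
    rw [h] at this
    exact this.elim
  · obtain ⟨p, hp, hmin⟩ := Set.exists_min_image _ (fun p : S × S => q p.1 p.2) hfin h
    exact ⟨q p.1 p.2, hp, fun u v huv => hmin (u, v) huv⟩

theorem exp_mul_pMet (H : S → ℝ) (q : S → S → ℝ) (β : ℝ) {u v : S} (huv : u ≠ v) :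
    Real.exp (-(β * H u)) * pMet H q β u v = q u v * Real.exp (-(β * max (H u) (H v))) := by
  rw [pMet, if_neg huv, mul_left_comm, ← Real.exp_add]
  congr 2
  have : max (H v - H u) 0 = max (H u) (H v) - H u := by
    rw [max_comm (H u), ← max_sub_sub_right, sub_self]
  rw [this]
  ring

theorem pMet_reversible (H : S → ℝ) {q : S → S → ℝ} (hsym : ∀ x y, q x y = q y x) (β : ℝ)
    (u v : S) :
    Real.exp (-(β * H u)) * pMet H q β u v = Real.exp (-(β * H v)) * pMet H q β v u := by
  by_cases huv : u = v
  · rw [huv]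
  · rw [exp_mul_pMet H q β huv, exp_mul_pMet H q β (Ne.symm huv), hsym u v, max_comm]

theorem sq_sub_le_of_edgeBelow {H : S → ℝ} {q : S → S → ℝ} (hq : ∀ x y, 0 ≤ q x y)
    (hsum : ∀ x : S, ∑ y ∈ Finset.univ.erase x, q x y ≤ 1) (hsym : ∀ x y : S, q x y = q y x)
    {r : ℝ} (hr : 0 < r) (hrq : ∀ u v, 0 < q u v → r ≤ q u v) {β : ℝ} (hβ : 0 ≤ β) {l : ℝ}
    {f : S → ℝ} {E : ℝ} (hE : energy (pMet H q β) (fun u => Real.exp (-(β * H u))) f ≤ E)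
    (hE0 : 0 ≤ E) {u v : S} (huv : EdgeBelow H q l u v) :
    (f u - f v) ^ 2 ≤ 2 / r * (E * Real.exp (β * l)) := by
  by_cases hne : u = v
  · rw [hne, sub_self, zero_pow two_ne_zero]
    positivity
  have h1 := conductance_mul_sq_le_energy (pMet_nonneg hq hsum hβ) (sum_pMet H q β)
    (fun u => (Real.exp_pos (-(β * H u))).le) (pMet_reversible H hsym β) f u v
  rw [exp_mul_pMet H q β hne] at h1
  have h2 : r * Real.exp (-(β * l)) ≤ q u v * Real.exp (-(β * max (H u) (H v))) := by
    refine mul_le_mul (hrq u v huv.1) (Real.exp_le_exp.2 ?_) (Real.exp_nonneg _) (hq u v)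
    exact neg_le_neg (mul_le_mul_of_nonneg_left (max_le huv.2.1 huv.2.2) hβ)
  have h3 : r * Real.exp (-(β * l)) * (f u - f v) ^ 2 ≤ 2 * E :=
    (mul_le_mul_of_nonneg_right h2 (sq_nonneg _)).trans (h1.trans (by linarith))
  have h4 : Real.exp (-(β * l)) * Real.exp (β * l) = 1 := by
    rw [← Real.exp_add]; simp
  calc (f u - f v) ^ 2 = (r * Real.exp (-(β * l)) * (f u - f v) ^ 2) * (Real.exp (β * l) / r) := by
        field_simp
        linear_combination (-(f u - f v) ^ 2) * h4
    _ ≤ 2 * E * (Real.exp (β * l) / r) :=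
        mul_le_mul_of_nonneg_right h3 (by positivity)
    _ = _ := by ring

theorem exists_surv_upper_bound {H : S → ℝ} {q : S → S → ℝ} (hq : ∀ x y, 0 ≤ q x y)
    (hsum : ∀ x : S, ∑ y ∈ Finset.univ.erase x, q x y ≤ 1) (hsym : ∀ x y : S, q x y = q y x)
    {A : Set S} {m l : ℝ} (hm : ∀ a ∈ A, m ≤ H a)
    (hl : ∀ z ∈ A, ∃ y ∉ A, Relation.ReflTransGen (EdgeBelow H q l) z y) :
    ∃ C : ℝ, ∀ β : ℝ, 0 ≤ β → ∀ (n : ℕ), ∀ x ∈ A,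
      n * surv (pMet H q β) A (n - 1) x ≤ C * Real.exp (β * (l - m)) := by
  obtain ⟨r, hr, hrq⟩ := exists_pos_le_connectivity q
  obtain ⟨K, hK0, hK⟩ := exists_oscillation_bound (EdgeBelow H q l)
  refine ⟨K ^ 2 * (2 / r * Fintype.card S), fun β hβ n x hx => ?_⟩
  have hP := pMet_nonneg hq hsum (H := H) hβ
  have hP1 := sum_pMet H q β
  set P := pMet H q β with hPdef
  set μ : S → ℝ := fun u => Real.exp (-(β * H u)) with hμ
  set F : S → ℝ := fun z => ∑ t ∈ Finset.range n, surv P A t z with hF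
  have hF0 : ∀ z, 0 ≤ F z := fun z => Finset.sum_nonneg fun t _ => surv_nonneg hP A t z
  have hFA : ∀ z ∉ A, F z = 0 := fun z hz =>
    Finset.sum_eq_zero fun t _ => surv_of_notMem P hz t
  have hFP : ∀ z ∈ A, F z - ∑ v, P z v * F v = 1 - surv P A n z := by
    intro z hz
    have : ∑ v, P z v * F v = ∑ t ∈ Finset.range n, surv P A (t + 1) z := by
      simp only [hF, Finset.mul_sum]
      rw [Finset.sum_comm]
      exact Finset.sum_congr rfl fun t _ => (surv_succ P hz t).symm
    rw [this, hF, ← Finset.sum_sub_distrib, Finset.sum_range_sub', surv_zero P hz]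
  have : Nonempty S := ⟨x⟩
  obtain ⟨w, hw⟩ := Finite.exists_max F
  have hEn : energy P μ F ≤ Fintype.card S * (Real.exp (-(β * m)) * F w) := by
    rw [energy, ← nsmul_eq_mul]
    refine Finset.sum_le_card_nsmul _ _ _ fun u _ => ?_
    by_cases hu : u ∈ A
    · refine mul_le_mul (Real.exp_le_exp.2 (neg_le_neg (mul_le_mul_of_nonneg_left (hm u hu) hβ)))
        ?_ ?_ (Real.exp_nonneg _)
      · rw [hFP u hu]
        exact (mul_le_of_le_one_right (hF0 u)
          (by linarith [surv_nonneg hP A n u])).trans (hw u)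
      · rw [hFP u hu]
        exact mul_nonneg (hF0 u) (by linarith [surv_le_one hP hP1 A n u])
    · rw [hFA u hu, zero_mul, mul_zero]
      exact mul_nonneg (Real.exp_nonneg _) (hF0 w)
  have hFx : n * surv P A (n - 1) x ≤ F x := by
    rw [hF, ← nsmul_eq_mul]
    calc n • surv P A (n - 1) x = (Finset.range n).card • surv P A (n - 1) x := by
          rw [Finset.card_range]
      _ ≤ _ := Finset.card_nsmul_le_sum _ _ _ fun t ht =>
          surv_antitone hP hP1 A x (by have := Finset.mem_range.1 ht; omega)
  refine (hFx.trans (hw x)).trans ?_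
  by_cases hwA : w ∈ A
  swap
  · rw [hFA w hwA]
    positivity
  obtain ⟨y, hyA, hwy⟩ := hl w hwA
  set Q : ℝ := 2 / r * (Fintype.card S * (Real.exp (-(β * m)) * F w) * Real.exp (β * l)) with hQ
  have hQ0 : 0 ≤ Q := by
    have := hF0 w
    positivity
  have h1 := hK w y hwy F (Real.sqrt Q) (Real.sqrt_nonneg _) fun u v huv =>
    Real.abs_le_sqrt (sq_sub_le_of_edgeBelow hq hsum hsym hr hrq hβ hEn
      (by have := hF0 w; positivity) huv)
  rw [hFA y hyA, sub_zero, abs_of_nonneg (hF0 w)] at h1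
  have h2 : F w * F w ≤ K ^ 2 * Q := by
    calc F w * F w ≤ (K * Real.sqrt Q) * (K * Real.sqrt Q) :=
          mul_le_mul h1 h1 (hF0 w) ((hF0 w).trans h1)
      _ = K ^ 2 * (Real.sqrt Q * Real.sqrt Q) := by ring
      _ = _ := by rw [Real.mul_self_sqrt hQ0]
  have h3 : K ^ 2 * Q = K ^ 2 * (2 / r * Fintype.card S) * Real.exp (β * (l - m)) * F w := by
    have : Real.exp (β * (l - m)) = Real.exp (-(β * m)) * Real.exp (β * l) := by
      rw [← Real.exp_add]; ring_nf
    rw [hQ, this]; ring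
  rcases (hF0 w).eq_or_lt with h0 | h0
  · rw [← h0]; positivity
  · exact le_of_mul_le_mul_right (h3 ▸ h2) h0

theorem exists_surv_lower_bound {H : S → ℝ} {q : S → S → ℝ} (hq : ∀ x y, 0 ≤ q x y ∧ q x y ≤ 1)
    (hsum : ∀ x : S, ∑ y ∈ Finset.univ.erase x, q x y ≤ 1) (hsym : ∀ x y : S, q x y = q y x)
    {A : Set S} {b x : S} (hb : b ∈ A) {l l' : ℝ} (hl : ∀ y ∈ extBoundary q A, l ≤ H y)
    (hl' : Relation.ReflTransGen (EdgeBelow H q l') x b) :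
    ∃ C : ℝ, ∀ β : ℝ, 0 ≤ β → ∀ (n : ℕ),
      1 - surv (pMet H q β) A n x ≤
        C * (n * Real.exp (-(β * (l - H b)))) + C * Real.exp (-(β * ((l - l') / 2))) := by
  obtain ⟨r, hr, hrq⟩ := exists_pos_le_connectivity q
  obtain ⟨K, hK0, hK⟩ := exists_oscillation_bound (EdgeBelow H q l')
  have hq0 : ∀ x y, 0 ≤ q x y := fun x y => (hq x y).1
  refine ⟨max ((Fintype.card S : ℝ) ^ 2) (K * Real.sqrt (2 / r * (Fintype.card S : ℝ) ^ 2)),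
    fun β hβ n => ?_⟩
  have hP := pMet_nonneg hq0 hsum (H := H) hβ
  have hP1 := sum_pMet H q β
  have hrev := pMet_reversible H hsym β
  have hc := fun u v (h : u ≠ v) => exp_mul_pMet H q β h
  set P := pMet H q β with hPdef
  set Φ : ℝ := (Fintype.card S : ℝ) ^ 2 * Real.exp (-(β * l)) with hΦ
  have hΦ0 : 0 ≤ Φ := by positivity
  have hcut : ∀ u ∈ A, ∀ v ∉ A, Real.exp (-(β * H u)) * P u v ≤ Real.exp (-(β * l)) := by
    intro u hu v hv
    rw [hc u v fun h => hv (h ▸ hu)]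
    rcases (hq0 u v).eq_or_lt with h0 | h0
    · rw [← h0, zero_mul]; exact Real.exp_nonneg _
    · refine (mul_le_of_le_one_left (Real.exp_nonneg _) (hq u v).2).trans (Real.exp_le_exp.2 ?_)
      exact neg_le_neg (mul_le_mul_of_nonneg_left
        ((hl v ⟨hv, u, hu, h0⟩).trans (le_max_right _ _)) hβ)
  have hflux : ∀ t, ∑ u, Real.exp (-(β * H u)) * (surv P A t u - surv P A (t + 1) u) ≤ Φ := by
    intro t
    have e1 : ∀ u, Real.exp (-(β * H u)) * surv P A t u =
        ∑ v, Real.exp (-(β * H v)) * P v u * surv P A t u := fun u => by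
      simp_rw [← hrev u, mul_right_comm _ (P u _), ← Finset.mul_sum, hP1, mul_one]
    simp only [mul_sub, Finset.sum_sub_distrib]
    rw [Finset.sum_congr rfl fun u _ => e1 u, Finset.sum_comm, ← Finset.sum_sub_distrib]
    have hcard : Φ = (Finset.univ : Finset S).card •
        ((Fintype.card S : ℝ) * Real.exp (-(β * l))) := by
      rw [nsmul_eq_mul, Finset.card_univ, hΦ]; ring
    rw [hcard]
    refine Finset.sum_le_card_nsmul _ _ _ fun v _ => ?_
    by_cases hv : v ∈ A
    · rw [surv_succ P hv, Finset.mul_sum]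
      simp only [mul_assoc, sub_self]
      positivity
    · rw [surv_of_notMem P hv, mul_zero, sub_zero, ← nsmul_eq_mul]
      refine Finset.sum_le_card_nsmul _ _ _ fun u _ => ?_
      by_cases hu : u ∈ A
      · rw [hrev v u]
        refine (mul_le_of_le_one_right ?_ (surv_le_one hP hP1 A t u)).trans (hcut u hu v hv)
        exact mul_nonneg (Real.exp_nonneg _) (hP u v)
      · rw [surv_of_notMem P hu, mul_zero]; exact Real.exp_nonneg _
  have hdec : ∀ t u, 0 ≤ surv P A t u - surv P A (t + 1) u := fun t u =>
    sub_nonneg.2 (surv_antitone hP hP1 A u (Nat.le_succ t))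
  have hEn : energy P (fun u => Real.exp (-(β * H u))) (surv P A n) ≤ Φ := by
    refine le_trans (Finset.sum_le_sum fun u _ => ?_) (hflux n)
    refine mul_le_mul_of_nonneg_left ?_ (Real.exp_nonneg _)
    by_cases hu : u ∈ A
    · rw [← surv_succ P hu]
      exact mul_le_of_le_one_left (hdec n u) (surv_le_one hP hP1 A n u)
    · rw [surv_of_notMem P hu, zero_mul]; simp [surv_of_notMem P hu]
  have hbot : 1 - surv P A n b ≤ n * (Φ * Real.exp (β * H b)) := by
    have h1 : ∀ t, surv P A t b - surv P A (t + 1) b ≤ Φ * Real.exp (β * H b) := by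
      intro t
      have h2 := (Finset.single_le_sum (f := fun u => Real.exp (-(β * H u)) *
        (surv P A t u - surv P A (t + 1) u)) (fun u _ =>
          mul_nonneg (Real.exp_nonneg _) (hdec t u)) (Finset.mem_univ b)).trans (hflux t)
      have h4 : Real.exp (-(β * H b)) * Real.exp (β * H b) = 1 := by
        rw [← Real.exp_add]; simp
      have h5 := mul_le_mul_of_nonneg_right h2 (Real.exp_nonneg (β * H b))
      linear_combination h5 - (surv P A t b - surv P A (t + 1) b) * h4
    rw [← surv_zero P hb, ← Finset.sum_range_sub' (fun t => surv P A t b), ← nsmul_eq_mul]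
    calc _ ≤ (Finset.range n).card • (Φ * Real.exp (β * H b)) :=
          Finset.sum_le_card_nsmul _ _ _ fun t _ => h1 t
      _ = _ := by rw [Finset.card_range]
  set D := Real.sqrt (2 / r * (Fintype.card S : ℝ) ^ 2) * Real.exp (-(β * ((l - l') / 2))) with hD
  have hD2 : D ^ 2 = 2 / r * (Φ * Real.exp (β * l')) := by
    rw [hD, mul_pow, Real.sq_sqrt (by positivity), hΦ, ← Real.exp_nat_mul,
      mul_assoc ((Fintype.card S : ℝ) ^ 2), ← Real.exp_add, mul_assoc]
    congr 3
    push_cast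
    ring
  have hD0 : 0 ≤ D := by positivity
  have hosc := hK x b hl' (surv P A n) D hD0 fun u v huv =>
    abs_le_of_sq_le_sq (hD2 ▸ sq_sub_le_of_edgeBelow hq0 hsum hsym hr hrq hβ hEn hΦ0 huv) hD0
  have h6 : n * (Φ * Real.exp (β * H b)) =
      (Fintype.card S : ℝ) ^ 2 * (n * Real.exp (-(β * (l - H b)))) := by
    have : Real.exp (-(β * (l - H b))) = Real.exp (-(β * l)) * Real.exp (β * H b) := by
      rw [← Real.exp_add]; ring_nf
    rw [hΦ, this]; ring
  have h7 := (abs_le.1 hosc).1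
  have h8 := mul_le_mul_of_nonneg_right (le_max_left ((Fintype.card S : ℝ) ^ 2)
    (K * Real.sqrt (2 / r * (Fintype.card S : ℝ) ^ 2)))
    (by positivity : 0 ≤ n * Real.exp (-(β * (l - H b))))
  have h9 := mul_le_mul_of_nonneg_right (le_max_right ((Fintype.card S : ℝ) ^ 2)
    (K * Real.sqrt (2 / r * (Fintype.card S : ℝ) ^ 2)))
    (Real.exp_nonneg (-(β * ((l - l') / 2))))
  have h10 : K * D = K * Real.sqrt (2 / r * (Fintype.card S : ℝ) ^ 2) *
    Real.exp (-(β * ((l - l') / 2))) := by rw [hD]; ring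
  linarith

/-- `u` and `v` communicate and both lie in `A`. -/
def EdgeIn (q : S → S → ℝ) (A : Set S) (u v : S) : Prop := 0 < q u v ∧ u ∈ A ∧ v ∈ A

/-- The minimal energy of `A`. -/
noncomputable def bottom (H : S → ℝ) (A : Set S) : ℝ := sInf (H '' A)

/-- The energy level that has to be reached to leave `A`. -/
noncomputable def exitLevel (H : S → ℝ) (q : S → S → ℝ) (A : Set S) : ℝ :=
  max (sSup (H '' A)) (sInf (H '' extBoundary q A))

/-- A connected set which is a singleton or lies strictly below its exterior boundary. -/
def IsWell (H : S → ℝ) (q : S → S → ℝ) (A : Set S) : Prop :=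
  (∀ x ∈ A, ∀ y ∈ A, Relation.ReflTransGen (EdgeIn q A) x y) ∧
    ((∃ x, A = {x}) ∨ ∀ x ∈ A, ∀ y ∈ extBoundary q A, H x < H y)

section
variable {S : Type*} [Finite S] {H : S → ℝ} {q : S → S → ℝ} {A : Set S}

theorem bottom_le {a : S} (ha : a ∈ A) : bottom H A ≤ H a :=
  csInf_le (Set.toFinite _).bddBelow ⟨a, ha, rfl⟩

theorem exists_eq_bottom (hA : A.Nonempty) : ∃ b ∈ A, H b = bottom H A :=
  (hA.image H).csInf_mem (Set.toFinite _)

theorem iInf_ofReal_sub (hA : A.Nonempty) (c : ℝ) :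
    ⨅ y ∈ A, ENNReal.ofReal (H y - c) = ENNReal.ofReal (bottom H A - c) := by
  refine le_antisymm ?_ (le_iInf₂ fun y hy => ENNReal.ofReal_le_ofReal ?_)
  · obtain ⟨y, hy, h⟩ := exists_eq_bottom (H := H) hA
    exact h ▸ iInf₂_le y hy
  · linarith [bottom_le (H := H) hy]

theorem le_sSup_image {a : S} (ha : a ∈ A) : H a ≤ sSup (H '' A) :=
  le_csSup (Set.toFinite _).bddAbove ⟨a, ha, rfl⟩

theorem le_exitLevel {a : S} (ha : a ∈ A) : H a ≤ exitLevel H q A :=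
  (le_sSup_image ha).trans (le_max_left _ _)

theorem bottom_le_exitLevel (hA : A.Nonempty) : bottom H A ≤ exitLevel H q A := by
  obtain ⟨a, ha⟩ := hA
  exact (bottom_le ha).trans (le_exitLevel ha)

theorem exists_extBoundary_le_exitLevel (hb : (extBoundary q A).Nonempty) :
    ∃ y ∈ extBoundary q A, H y ≤ exitLevel H q A := by
  obtain ⟨y, hy, h⟩ := exists_eq_bottom (H := H) hb
  exact ⟨y, hy, h.le.trans (le_max_right _ _)⟩

theorem IsWell.sSup_lt_or_eq (hW : IsWell H q A) (hA : A.Nonempty)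
    (hb : (extBoundary q A).Nonempty) :
    sSup (H '' A) < bottom H (extBoundary q A) ∨ sSup (H '' A) = bottom H A := by
  rcases hW.2 with ⟨x, rfl⟩ | h
  · right; simp [bottom]
  · left
    obtain ⟨y, hy, hyb⟩ := exists_eq_bottom (H := H) hb
    obtain ⟨a, ha, hat⟩ := (hA.image H).csSup_mem (Set.toFinite _)
    rw [← hyb, ← hat]
    exact h a ha y hy

theorem IsWell.exitLevel_le_or_eq (hW : IsWell H q A) (hA : A.Nonempty)
    (hb : (extBoundary q A).Nonempty) :
    (∀ y ∈ extBoundary q A, exitLevel H q A ≤ H y) ∨ exitLevel H q A = bottom H A := by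
  by_cases hlt : sSup (H '' A) ≤ bottom H (extBoundary q A)
  · left
    intro y hy
    exact max_le (hlt.trans (bottom_le hy)) (bottom_le hy)
  · right
    refine (max_eq_left (not_le.1 hlt).le).trans ?_
    exact (hW.sSup_lt_or_eq hA hb).resolve_left fun h => hlt h.le

theorem IsWell.exitLevel_le_of_mem_extBoundary (hW : IsWell H q A) {a y : S}
    (hy : y ∈ extBoundary q A) (ha : a ∈ A) {l : ℝ} (hal : H a ≤ l) (hyl : H y ≤ l) :
    exitLevel H q A ≤ l := by
  refine max_le ?_ ((bottom_le hy).trans hyl)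
  rcases hW.2 with ⟨x, rfl⟩ | h
  · rw [Set.mem_singleton_iff] at ha
    simpa [← ha] using hal
  · refine csSup_le ⟨_, a, ha, rfl⟩ ?_
    rintro _ ⟨b, hb, rfl⟩
    exact (h b hb y hy).le.trans hyl

end

section
variable {S : Type*} {q : S → S → ℝ}

theorem reflTransGen_of_joinedIn {G : Set S} {x y : S} (h : JoinedIn q G x y) :
    Relation.ReflTransGen (EdgeIn q G) x y := by
  obtain ⟨ω, hx, hy, hp, hG⟩ := h
  induction ω generalizing x with
  | nil => simp at hx
  | cons a l ih =>
    obtain rfl : a = x := by simpa using hx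
    rcases l with _ | ⟨b, l⟩
    · obtain rfl : a = y := by simpa using hy
      exact .refl
    · have hp' : 0 < q a b ∧ IsPath q (b :: l) := List.isChain_cons_cons.1 hp
      exact .head ⟨hp'.1, hG a (by simp), hG b (by simp)⟩
        (ih rfl (by simpa using hy) hp'.2 fun z hz => hG z (by simp_all))

theorem extBoundary_nonempty (hirr : ∀ x y : S, JoinedIn q Set.univ x y) {A : Set S}
    (hA : A.Nonempty) (hAS : A ≠ Set.univ) : (extBoundary q A).Nonempty := by
  obtain ⟨x, hx⟩ := hA
  obtain ⟨y, hy⟩ := (Set.ne_univ_iff_exists_notMem A).1 hAS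
  by_contra hne
  refine hy ?_
  have := reflTransGen_of_joinedIn (hirr x y)
  clear hy
  induction this with
  | refl => exact hx
  | @tail b c _ hbc ih =>
    by_contra hc
    exact hne ⟨c, hc, b, ih, hbc.1⟩

/-- One arrow of zero renormalized cost. -/
def ZeroStep (E : Set (Set S)) (V : Set S → Set S → ℝ≥0∞) (A B : Set S) : Prop :=
  A ∈ E ∧ B ∈ E ∧ VsAux E V A B = 0

theorem arrowAux_iff {E : Set (Set S)} {V : Set S → Set S → ℝ≥0∞} {A B : Set S} :
    arrowAux E V A B ↔ A ∈ E ∧ Relation.ReflTransGen (ZeroStep E V) A B := by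
  constructor
  · rintro ⟨l, hA, hB, hE, hc⟩
    induction l generalizing A with
    | nil => simp at hA
    | cons a l ih =>
      obtain rfl : a = A := by simpa using hA
      refine ⟨hE a (by simp), ?_⟩
      rcases l with _ | ⟨b, l⟩
      · obtain rfl : a = B := by simpa using hB
        exact .refl
      · simp only [listCost, add_eq_zero] at hc
        exact .head ⟨hE a (by simp), hE b (by simp), hc.1⟩
          (ih rfl (by simpa using hB) (fun z hz => hE z (by simp_all)) hc.2).2
  · rintro ⟨hAE, h⟩
    induction h using Relation.ReflTransGen.head_induction_on with
    | refl => exact ⟨[B], by simp, by simp, by simpa using hAE, rfl⟩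
    | @head a c hac _ ih =>
      obtain ⟨l, hc, hB, hE, h0⟩ := ih hac.2.1
      rcases l with _ | ⟨c', l⟩
      · simp at hc
      · obtain rfl : c' = c := by simpa using hc
        refine ⟨a :: c' :: l, rfl, by simpa using hB, ?_, ?_⟩
        · intro z hz
          rcases List.mem_cons.1 hz with rfl | hz
          · exact hAE
          · exact hE z hz
        · simp only [listCost, h0, hac.2.2, add_zero]

theorem arrowAux.trans {E : Set (Set S)} {V : Set S → Set S → ℝ≥0∞} {A B C : Set S}
    (h : arrowAux E V A B) (h' : arrowAux E V B C) : arrowAux E V A C := by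
  rw [arrowAux_iff] at *
  exact ⟨h.1, h.2.trans h'.2⟩

theorem arrowAux_refl {E : Set (Set S)} {V : Set S → Set S → ℝ≥0∞} {A : Set S} (hA : A ∈ E) :
    arrowAux E V A A := arrowAux_iff.2 ⟨hA, .refl⟩

end

/-- The invariant of the recursive construction: `E` is a partition into wells, and `V A B` is the
height above the bottom of `A` of the lowest point of `B` through which `A` can be left. -/
structure WellPartition (H : S → ℝ) (q : S → S → ℝ) (E : Set (Set S))
    (V : Set S → Set S → ℝ≥0∞) : Prop where
  nonempty : ∀ A ∈ E, A.Nonempty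
  cover : ∀ x, ∃ A ∈ E, x ∈ A
  eq_of_mem : ∀ A ∈ E, ∀ B ∈ E, ∀ x ∈ A, x ∈ B → A = B
  isWell : ∀ A ∈ E, IsWell H q A
  cost : ∀ A ∈ E, ∀ B ∈ E, A ≠ B →
    V A B = ⨅ y ∈ B ∩ extBoundary q A, ENNReal.ofReal (H y - bottom H A)

namespace WellPartition
variable {S : Type*} [Finite S] {H : S → ℝ} {q : S → S → ℝ} {E : Set (Set S)}
  {V : Set S → Set S → ℝ≥0∞} {A B C : Set S}

theorem heAux_eq (h : WellPartition H q E V) (hirr : ∀ x y : S, JoinedIn q Set.univ x y)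
    (hA : A ∈ E) (hAS : A ≠ Set.univ) :
    HeAux E V A = ENNReal.ofReal (exitLevel H q A - bottom H A) := by
  have hne := h.nonempty A hA
  have hb := extBoundary_nonempty hirr hne hAS
  refine le_antisymm ?_ (le_iInf₂ fun B hB => ?_)
  · obtain ⟨y, hy, hyl⟩ := exists_extBoundary_le_exitLevel (H := H) hb
    obtain ⟨B, hB, hyB⟩ := h.cover y
    have hBA : B ≠ A := fun e => hy.1 (e ▸ hyB)
    refine (iInf₂_le B ⟨hB, hBA⟩).trans ?_
    rw [h.cost A hA B hB hBA.symm]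
    exact (iInf₂_le y ⟨hyB, hy⟩).trans (ENNReal.ofReal_le_ofReal (by linarith))
  · rw [h.cost A hA B hB.1 (Ne.symm hB.2)]
    refine le_iInf₂ fun y hy => ?_
    rcases (h.isWell A hA).exitLevel_le_or_eq hne hb with h1 | h1
    · exact ENNReal.ofReal_le_ofReal (by linarith [h1 y hy.2])
    · simp [h1]

theorem vsAux_eq (h : WellPartition H q E V) (hirr : ∀ x y : S, JoinedIn q Set.univ x y)
    (hA : A ∈ E) (hAS : A ≠ Set.univ) (hB : B ∈ E) (hAB : A ≠ B) :
    VsAux E V A B = ⨅ y ∈ B ∩ extBoundary q A, ENNReal.ofReal (H y - exitLevel H q A) := by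
  rw [VsAux, h.heAux_eq hirr hA hAS, h.cost A hA B hB hAB]
  have h0 : 0 ≤ exitLevel H q A - bottom H A :=
    sub_nonneg.2 (bottom_le_exitLevel (h.nonempty A hA))
  rcases (B ∩ extBoundary q A).eq_empty_or_nonempty with he | hne
  · simp [he]
  · rw [iInf_ofReal_sub hne, iInf_ofReal_sub hne, ← ENNReal.ofReal_sub _ h0,
      sub_sub_sub_cancel_right]

theorem vsAux_eq_zero_iff (h : WellPartition H q E V)
    (hirr : ∀ x y : S, JoinedIn q Set.univ x y)
    (hA : A ∈ E) (hAS : A ≠ Set.univ) (hB : B ∈ E) (hAB : A ≠ B) :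
    VsAux E V A B = 0 ↔ ∃ y ∈ B ∩ extBoundary q A, H y ≤ exitLevel H q A := by
  rw [h.vsAux_eq hirr hA hAS hB hAB]
  constructor
  · intro h0
    rcases (B ∩ extBoundary q A).eq_empty_or_nonempty with he | hne
    · simp [he] at h0
    · obtain ⟨y, hy, hyb⟩ := exists_eq_bottom (H := H) hne
      rw [iInf_ofReal_sub hne, ENNReal.ofReal_eq_zero] at h0
      exact ⟨y, hy, by linarith⟩
  · rintro ⟨y, hy, hyl⟩
    refine le_antisymm ((iInf₂_le y hy).trans ?_) zero_le
    simp [hyl]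

theorem exitLevel_le_of_zeroStep (h : WellPartition H q E V) (hsym : ∀ x y : S, q x y = q y x)
    (hirr : ∀ x y : S, JoinedIn q Set.univ x y) (hAB : ZeroStep E V A B) (hAS : A ≠ Set.univ) :
    B ≠ Set.univ ∧ exitLevel H q B ≤ exitLevel H q A := by
  obtain ⟨hA, hB, h0⟩ := hAB
  by_cases hne : A = B
  · subst hne; exact ⟨hAS, le_rfl⟩
  obtain ⟨y, ⟨hyB, hyA, a, haA, hay⟩, hyl⟩ := (h.vsAux_eq_zero_iff hirr hA hAS hB hne).1 h0
  have haB : a ∉ B := fun haB => hne (h.eq_of_mem A hA B hB a haA haB)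
  refine ⟨fun e => haB (e ▸ Set.mem_univ a), ?_⟩
  exact (h.isWell B hB).exitLevel_le_of_mem_extBoundary ⟨haB, y, hyB, hsym a y ▸ hay⟩ hyB hyl
    (le_exitLevel haA)

theorem exitLevel_le_of_arrowAux (h : WellPartition H q E V) (hsym : ∀ x y : S, q x y = q y x)
    (hirr : ∀ x y : S, JoinedIn q Set.univ x y) (hAB : arrowAux E V A B) (hAS : A ≠ Set.univ) :
    B ≠ Set.univ ∧ exitLevel H q B ≤ exitLevel H q A := by
  induction (arrowAux_iff.1 hAB).2 with
  | refl => exact ⟨hAS, le_rfl⟩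
  | tail hb hbc ih =>
    have ih := ih (arrowAux_iff.2 ⟨(arrowAux_iff.1 hAB).1, hb⟩)
    have := h.exitLevel_le_of_zeroStep hsym hirr hbc ih.1
    exact ⟨this.1, this.2.trans ih.2⟩

omit [Finite S] in
theorem subset_of_mem_DAux (h : WellPartition H q E V) (hC : C ∈ DAux E V) (hB : B ∈ E) {x : S}
    (hxC : x ∈ C) (hxB : x ∈ B) : B ⊆ C := by
  obtain ⟨A, hA, rfl⟩ := hC
  obtain ⟨A', hA', hxA'⟩ := hxC
  obtain rfl := h.eq_of_mem A' hA'.1 B hB x hxA' hxB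
  exact Set.subset_sUnion_of_mem hA'

omit [Finite S] in
theorem arrowAux_of_subset (h : WellPartition H q E V) (hC : C ∈ DAux E V) (hA : A ∈ E)
    (hB : B ∈ E) (hAC : A ⊆ C) (hBC : B ⊆ C) : arrowAux E V A B := by
  obtain ⟨D, hD, rfl⟩ := hC
  have key : ∀ F ∈ E, F ⊆ ⋃₀ {A' | A' ∈ E ∧ arrowAux E V D A' ∧ arrowAux E V A' D} →
      arrowAux E V D F ∧ arrowAux E V F D := by
    intro F hF hFC
    obtain ⟨x, hx⟩ := h.nonempty F hF
    obtain ⟨A', hA', hxA'⟩ := hFC hx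
    obtain rfl := h.eq_of_mem A' hA'.1 F hF x hxA' hx
    exact hA'.2
  exact (key A hA hAC).2.trans (key B hB hBC).1

omit [Finite S] in
theorem subset_of_arrowAux (h : WellPartition H q E V) (hC : C ∈ DAux E V) (hA : A ∈ E)
    (hB : B ∈ E) (hAC : A ⊆ C) (hAB : arrowAux E V A B) (hBA : arrowAux E V B A) : B ⊆ C := by
  obtain ⟨D, hD, rfl⟩ := hC
  obtain ⟨x, hx⟩ := h.nonempty A hA
  obtain ⟨A', hA', hxA'⟩ := hAC hx
  obtain rfl := h.eq_of_mem A' hA'.1 A hA x hxA' hx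
  exact Set.subset_sUnion_of_mem ⟨hB, hA'.2.1.trans hAB, hBA.trans hA'.2.2⟩

omit [Finite S] in
theorem exists_DAux_superset (hA : A ∈ E) : ∃ C ∈ DAux E V, A ⊆ C :=
  ⟨_, ⟨A, hA, rfl⟩, Set.subset_sUnion_of_mem ⟨hA, arrowAux_refl hA, arrowAux_refl hA⟩⟩

omit [Finite S] in
theorem DAux_subset_of_mem (h : WellPartition H q E V) {C' : Set S} (hC : C ∈ DAux E V)
    (hC' : C' ∈ DAux E V) {x : S} (hx : x ∈ C) (hx' : x ∈ C') : C ⊆ C' := by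
  obtain ⟨A, hA, hxA⟩ := h.cover x
  intro z hz
  obtain ⟨B, hB, hzB⟩ := h.cover z
  have hAC := h.subset_of_mem_DAux hC hA hx hxA
  have hBC := h.subset_of_mem_DAux hC hB hz hzB
  exact h.subset_of_arrowAux hC' hA hB (h.subset_of_mem_DAux hC' hA hx' hxA)
    (h.arrowAux_of_subset hC hA hB hAC hBC) (h.arrowAux_of_subset hC hB hA hBC hAC) hzB

omit [Finite S] in
theorem DAux_eq_of_mem (h : WellPartition H q E V) {C' : Set S} (hC : C ∈ DAux E V)
    (hC' : C' ∈ DAux E V) {x : S} (hx : x ∈ C) (hx' : x ∈ C') : C = C' :=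
  (h.DAux_subset_of_mem hC hC' hx hx').antisymm (h.DAux_subset_of_mem hC' hC hx' hx)

omit [Finite S] in
theorem nonempty_of_mem_DAux (h : WellPartition H q E V) (hC : C ∈ DAux E V) : C.Nonempty := by
  obtain ⟨A, hA, rfl⟩ := hC
  exact (h.nonempty A hA).mono
    (Set.subset_sUnion_of_mem ⟨hA, arrowAux_refl hA, arrowAux_refl hA⟩)

omit [Finite S] in
theorem ne_univ_of_subset {A C : Set S} (hAC : A ⊆ C) (hCS : C ≠ Set.univ) : A ≠ Set.univ :=
  fun e => hCS (Set.univ_subset_iff.1 (e ▸ hAC))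

theorem exitLevel_eq_of_subset (h : WellPartition H q E V) (hsym : ∀ x y : S, q x y = q y x)
    (hirr : ∀ x y : S, JoinedIn q Set.univ x y) (hC : C ∈ DAux E V) (hCS : C ≠ Set.univ)
    (hA : A ∈ E) (hB : B ∈ E) (hAC : A ⊆ C) (hBC : B ⊆ C) :
    exitLevel H q A = exitLevel H q B :=
  le_antisymm
    (h.exitLevel_le_of_arrowAux hsym hirr (h.arrowAux_of_subset hC hB hA hBC hAC)
      (ne_univ_of_subset hBC hCS)).2
    (h.exitLevel_le_of_arrowAux hsym hirr (h.arrowAux_of_subset hC hA hB hAC hBC)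
      (ne_univ_of_subset hAC hCS)).2

theorem exitLevel_lt_of_DstarAux (h : WellPartition H q E V) (hsym : ∀ x y : S, q x y = q y x)
    (hirr : ∀ x y : S, JoinedIn q Set.univ x y) (hC : C ∈ DstarAux E V)
    (hA : A ∈ E) (hAC : A ⊆ C) {y : S} (hy : y ∈ extBoundary q C) :
    exitLevel H q A < H y := by
  obtain ⟨hyC, a, haC, hay⟩ := hy
  have hCS : C ≠ Set.univ := fun e => hyC (e ▸ Set.mem_univ y)
  obtain ⟨A', hA', haA'⟩ := h.cover a
  have hA'C := h.subset_of_mem_DAux hC.1 hA' haC haA'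
  rw [h.exitLevel_eq_of_subset hsym hirr hC.1 hCS hA hA' hAC hA'C]
  by_contra hle
  obtain ⟨B, hB, hyB⟩ := h.cover y
  have hne : A' ≠ B := fun e => hyC (hA'C (e ▸ hyB))
  have h0 := (h.vsAux_eq_zero_iff hirr hA' (ne_univ_of_subset hA'C hCS) hB hne).2
    ⟨y, ⟨hyB, fun e => hyC (hA'C e), a, haA', hay⟩, not_lt.1 hle⟩
  obtain ⟨C', hC', hBC'⟩ := exists_DAux_superset (V := V) hB
  have := hC.2 C' hC' ⟨A', hA', B, hB, hA'C, hBC',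
    arrowAux_iff.2 ⟨hA', .single ⟨hA', hB, h0⟩⟩⟩
  exact hyC (this ▸ hBC' hyB)

theorem reflTransGen_edgeIn_of_arrowAux (h : WellPartition H q E V)
    (hirr : ∀ x y : S, JoinedIn q Set.univ x y) (hC : C ∈ DAux E V) (hA : A ∈ E) (hAC : A ⊆ C)
    (hAB : arrowAux E V A B) (hBA : arrowAux E V B A) :
    ∀ x ∈ A, ∀ y ∈ B, Relation.ReflTransGen (EdgeIn q C) x y := by
  have hmono : ∀ F ∈ E, F ⊆ C → ∀ x ∈ F, ∀ y ∈ F, Relation.ReflTransGen (EdgeIn q C) x y :=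
    fun F hF hFC x hx y hy => ((h.isWell F hF).1 x hx y hy).lift id
      fun u v huv => ⟨huv.1, hFC huv.2.1, hFC huv.2.2⟩
  induction (arrowAux_iff.1 hAB).2 with
  | refl => exact hmono A hA hAC
  | @tail F G hAF hFG ih =>
    have hFA : arrowAux E V F A := (arrowAux_iff.2 ⟨hFG.1, .single hFG⟩).trans hBA
    have hAF' : arrowAux E V A F := arrowAux_iff.2 ⟨hA, hAF⟩
    have ih := ih hAF' hFA
    have hFC := h.subset_of_arrowAux hC hA hFG.1 hAC hAF' hFA
    have hGC := h.subset_of_arrowAux hC hA hFG.2.1 hAC hAB hBA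
    by_cases hne : F = G
    · exact hne ▸ ih
    by_cases hFS : F = Set.univ
    · obtain ⟨z, hz⟩ := h.nonempty G hFG.2.1
      exact absurd (h.eq_of_mem F hFG.1 G hFG.2.1 z (hFS ▸ Set.mem_univ z) hz) hne
    obtain ⟨z, ⟨hzG, hzF, w, hwF, hwz⟩, -⟩ :=
      (h.vsAux_eq_zero_iff hirr hFG.1 hFS hFG.2.1 hne).1 hFG.2.2
    intro x hx y hy
    exact ((ih x hx w hwF).tail ⟨hwz, hFC hwF, hGC hzG⟩).trans (hmono G hFG.2.1 hGC z hzG y hy)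

theorem isWell_of_DstarAux (h : WellPartition H q E V) (hsym : ∀ x y : S, q x y = q y x)
    (hirr : ∀ x y : S, JoinedIn q Set.univ x y) (hC : C ∈ DstarAux E V) : IsWell H q C := by
  refine ⟨fun x hx y hy => ?_, Or.inr fun x hx y hy => ?_⟩
  · obtain ⟨A, hA, hxA⟩ := h.cover x
    obtain ⟨B, hB, hyB⟩ := h.cover y
    have hAC := h.subset_of_mem_DAux hC.1 hA hx hxA
    have hBC := h.subset_of_mem_DAux hC.1 hB hy hyB
    exact h.reflTransGen_edgeIn_of_arrowAux hirr hC.1 hA hAC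
      (h.arrowAux_of_subset hC.1 hA hB hAC hBC) (h.arrowAux_of_subset hC.1 hB hA hBC hAC)
      x hxA y hyB
  · obtain ⟨A, hA, hxA⟩ := h.cover x
    exact (le_exitLevel hxA).trans_lt
      (h.exitLevel_lt_of_DstarAux hsym hirr hC hA (h.subset_of_mem_DAux hC.1 hA hx hxA) hy)

omit [Finite S] in
theorem subset_of_mem_EnextAux (h : WellPartition H q E V) (hC : C ∈ EnextAux E V) (hB : B ∈ E)
    {x : S} (hxC : x ∈ C) (hxB : x ∈ B) : B ⊆ C := by
  rcases hC with hC | hC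
  · exact h.subset_of_mem_DAux hC.1 hB hxC hxB
  · exact (h.eq_of_mem C hC.1 B hB x hxC hxB).ge

theorem exists_common_exitLevel (h : WellPartition H q E V) (hsym : ∀ x y : S, q x y = q y x)
    (hirr : ∀ x y : S, JoinedIn q Set.univ x y) (hC : C ∈ EnextAux E V) (hCS : C ≠ Set.univ) :
    ∃ M, bottom H C ≤ M ∧ (∀ B ∈ E, B ⊆ C → exitLevel H q B = M) ∧
      ∀ y ∈ extBoundary q C, M ≤ H y ∨ M = bottom H C := by
  rcases hC with hC | hC
  · obtain ⟨x, hx⟩ := h.nonempty_of_mem_DAux hC.1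
    obtain ⟨A, hA, hxA⟩ := h.cover x
    have hAC := h.subset_of_mem_DAux hC.1 hA hx hxA
    exact ⟨exitLevel H q A, (bottom_le hx).trans (le_exitLevel hxA),
      fun B hB hBC => h.exitLevel_eq_of_subset hsym hirr hC.1 hCS hB hA hBC hAC,
      fun y hy => Or.inl (h.exitLevel_lt_of_DstarAux hsym hirr hC hA hAC hy).le⟩
  · refine ⟨exitLevel H q C, bottom_le_exitLevel (h.nonempty C hC.1), fun B hB hBC => ?_,
      fun y hy => ?_⟩
    · obtain ⟨x, hx⟩ := h.nonempty B hB
      rw [h.eq_of_mem B hB C hC.1 x hx (hBC hx)]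
    · exact ((h.isWell C hC.1).exitLevel_le_or_eq (h.nonempty C hC.1) ⟨y, hy⟩).imp_left
        fun h1 => h1 y hy

theorem next_cost (h : WellPartition H q E V) (hsym : ∀ x y : S, q x y = q y x)
    (hirr : ∀ x y : S, JoinedIn q Set.univ x y) (hC : C ∈ EnextAux E V) (hA : A ∈ EnextAux E V)
    (hAne : A.Nonempty) (hCne : C.Nonempty) (hdisj : ∀ x ∈ C, x ∉ A) :
    VnextAux E V C A = ⨅ y ∈ A ∩ extBoundary q C, ENNReal.ofReal (H y - bottom H C) := by
  have hCS : C ≠ Set.univ := by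
    rintro rfl
    obtain ⟨a, ha⟩ := hAne
    exact hdisj a (Set.mem_univ a) ha
  obtain ⟨M, hbM, hM, hby⟩ := h.exists_common_exitLevel hsym hirr hC hCS
  have hHm : HmAux E V C = ENNReal.ofReal (M - bottom H C) := by
    refine le_antisymm (iSup₂_le fun B hB => ?_) ?_
    · rw [h.heAux_eq hirr hB.1 (ne_univ_of_subset hB.2 hCS), hM B hB.1 hB.2]
      obtain ⟨b, hb, hbb⟩ := exists_eq_bottom (H := H) (h.nonempty B hB.1)
      exact ENNReal.ofReal_le_ofReal (by linarith [bottom_le (H := H) (hB.2 hb)])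
    · obtain ⟨b, hb, hbb⟩ := exists_eq_bottom (H := H) hCne
      obtain ⟨B, hB, hbB⟩ := h.cover b
      have hBC := h.subset_of_mem_EnextAux hC hB hb hbB
      refine le_trans ?_ (le_iSup₂ (f := fun A' (_ : A' ∈ {A' | A' ∈ E ∧ A' ⊆ C}) =>
        HeAux E V A') B ⟨hB, hBC⟩)
      rw [h.heAux_eq hirr hB (ne_univ_of_subset hBC hCS), hM B hB hBC]
      exact ENNReal.ofReal_le_ofReal (by linarith [bottom_le (H := H) hbB])
  have hVs : (⨅ B ∈ {B | B ∈ E ∧ B ⊆ C}, ⨅ B' ∈ {B' | B' ∈ E ∧ B' ⊆ A}, VsAux E V B B') =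
      ⨅ y ∈ A ∩ extBoundary q C, ENNReal.ofReal (H y - M) := by
    refine le_antisymm (le_iInf₂ fun y hy => ?_)
      (le_iInf₂ fun B hB => le_iInf₂ fun B' hB' => ?_)
    · obtain ⟨hyA, hyC, c, hcC, hcy⟩ := hy
      obtain ⟨B, hB, hcB⟩ := h.cover c
      obtain ⟨B', hB', hyB'⟩ := h.cover y
      have hBC := h.subset_of_mem_EnextAux hC hB hcC hcB
      have hBA := h.subset_of_mem_EnextAux hA hB' hyA hyB'
      refine (iInf₂_le B ⟨hB, hBC⟩).trans ((iInf₂_le B' ⟨hB', hBA⟩).trans ?_)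
      rw [h.vsAux_eq hirr hB (ne_univ_of_subset hBC hCS) hB' fun e => hyC (hBC (e ▸ hyB')),
        hM B hB hBC]
      exact iInf₂_le y ⟨hyB', fun e => hyC (hBC e), c, hcB, hcy⟩
    · have hne : B ≠ B' := by
        obtain ⟨z, hz⟩ := h.nonempty B hB.1
        exact fun e => hdisj z (hB.2 hz) (hB'.2 (e ▸ hz))
      rw [h.vsAux_eq hirr hB.1 (ne_univ_of_subset hB.2 hCS) hB'.1 hne, hM B hB.1 hB.2]
      refine le_iInf₂ fun y hy => iInf₂_le y ⟨hB'.2 hy.1, fun e => hdisj y e (hB'.2 hy.1), ?_⟩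
      obtain ⟨-, -, b, hb, hby⟩ := hy
      exact ⟨b, hB.2 hb, hby⟩
  rw [VnextAux, hHm, hVs, ENNReal.add_iInf₂]
  refine iInf_congr fun y => iInf_congr fun hy => ?_
  rcases hby y hy.2 with h1 | h1
  · rw [← ENNReal.ofReal_add (by linarith) (by linarith)]
    congr 1
    ring
  · simp [h1]

theorem next (h : WellPartition H q E V) (hsym : ∀ x y : S, q x y = q y x)
    (hirr : ∀ x y : S, JoinedIn q Set.univ x y) :
    WellPartition H q (EnextAux E V) (VnextAux E V) := by
  have hne : ∀ A ∈ EnextAux E V, A.Nonempty := by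
    rintro A (hA | hA)
    · exact h.nonempty_of_mem_DAux hA.1
    · exact h.nonempty A hA.1
  have heq : ∀ A ∈ EnextAux E V, ∀ B ∈ EnextAux E V, ∀ x ∈ A, x ∈ B → A = B := by
    rintro A (hA | ⟨hA, C, hC, hAC⟩) B (hB | ⟨hB, D, hD, hBD⟩) x hxA hxB
    · exact h.DAux_eq_of_mem hA.1 hB.1 hxA hxB
    · exact absurd (h.DAux_eq_of_mem hA.1 hD.1 hxA (hBD hxB) ▸ hA) hD.2
    · exact absurd (h.DAux_eq_of_mem hB.1 hC.1 hxB (hAC hxA) ▸ hB) hC.2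
    · exact h.eq_of_mem A hA B hB x hxA hxB
  refine ⟨hne, fun x => ?_, heq, ?_, fun A hA B hB hAB => ?_⟩
  · obtain ⟨A, hA, hxA⟩ := h.cover x
    obtain ⟨C, hC, hAC⟩ := exists_DAux_superset (V := V) hA
    by_cases hCs : C ∈ DstarAux E V
    · exact ⟨C, Or.inl hCs, hAC hxA⟩
    · exact ⟨A, Or.inr ⟨hA, C, ⟨hC, hCs⟩, hAC⟩, hxA⟩
  · rintro A (hA | hA)
    · exact h.isWell_of_DstarAux hsym hirr hA
    · exact h.isWell A hA.1
  · exact h.next_cost hsym hirr hA hB (hne B hB) (hne A hA)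
      fun x hxA hxB => hAB (heq A hA B hB x hxA hxB)

omit [Finite S] in
theorem singletons (H : S → ℝ) (q : S → S → ℝ) :
    WellPartition H q {A | ∃ i, A = {i}} (V0 H q) where
  nonempty := by rintro _ ⟨i, rfl⟩; exact Set.singleton_nonempty i
  cover x := ⟨{x}, ⟨x, rfl⟩, rfl⟩
  eq_of_mem := by
    rintro _ ⟨i, rfl⟩ _ ⟨j, rfl⟩ x hi hj
    rw [Set.mem_singleton_iff] at hi hj
    rw [← hi, ← hj]
  isWell := by
    rintro _ ⟨i, rfl⟩
    refine ⟨?_, Or.inl ⟨i, rfl⟩⟩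
    rintro x rfl y rfl
    exact .refl
  cost := by
    rintro _ ⟨i, rfl⟩ _ ⟨j, rfl⟩ hij
    have hij' : j ≠ i := fun e => hij (by rw [e])
    have hbot : bottom H {i} = H i := by simp [bottom]
    rw [hbot]
    refine le_antisymm (le_iInf₂ fun y hy => ?_) ?_
    · obtain ⟨rfl, -, _, rfl, hq⟩ := hy
      unfold V0
      refine iInf₂_le_of_le _ rfl (iInf₂_le_of_le y rfl (iInf_le_of_le ⟨rfl, rfl, hq⟩ le_rfl))
    · refine le_iInf₂ fun i' hi' => le_iInf₂ fun j' hj' => le_iInf fun hc => ?_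
      obtain rfl := hi'
      obtain rfl := hj'
      exact iInf₂_le j' ⟨rfl, hij', i', rfl, hc.2.2⟩

end WellPartition

omit [DecidableEq S] in
theorem wellPartition_cycEV (H : S → ℝ) {q : S → S → ℝ} (hsym : ∀ x y : S, q x y = q y x)
    (hirr : ∀ x y : S, JoinedIn q Set.univ x y) (k : ℕ) :
    WellPartition H q (Ecyc H q k) (Vcyc H q k) := by
  induction k with
  | zero => exact WellPartition.singletons H q
  | succ k ih => exact ih.next hsym hirr

omit [DecidableEq S] in
theorem heC_eq {H : S → ℝ} {q : S → S → ℝ} (hsym : ∀ x y : S, q x y = q y x)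
    (hirr : ∀ x y : S, JoinedIn q Set.univ x y) {A : Set S} (hA : A ∈ GraphCycles H q)
    (hAS : A ≠ Set.univ) :
    HeC H q A = ENNReal.ofReal (exitLevel H q A - bottom H A) := by
  have key : ∀ k, A ∈ Ecyc H q k →
      Hek H q k A = ENNReal.ofReal (exitLevel H q A - bottom H A) := fun k hk =>
    (wellPartition_cycEV H hsym hirr k).heAux_eq hirr hk hAS
  obtain ⟨k, hk⟩ := hA
  refine le_antisymm (iSup₂_le fun j hj => (key j hj).le) ?_
  rw [← key k hk]
  exact le_iSup₂ (f := fun k (_ : A ∈ Ecyc H q k) => Hek H q k A) k hk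

section
variable {S : Type*} [Finite S] {H : S → ℝ} {q : S → S → ℝ} {A : Set S}

/-- A non-degenerate well has its points joined strictly below its exit level. -/
theorem IsWell.sSup_lt_exitLevel (hW : IsWell H q A) (hA : A.Nonempty)
    (hb : (extBoundary q A).Nonempty) (hlt : bottom H A < exitLevel H q A) :
    sSup (H '' A) < exitLevel H q A := by
  rcases hW.sSup_lt_or_eq hA hb with h | h
  · exact h.trans_le (le_max_right _ _)
  · exact h ▸ hlt

omit [Finite S] in
theorem IsWell.reflTransGen_edgeBelow (hW : IsWell H q A) {l : ℝ} (hl : ∀ a ∈ A, H a ≤ l) {x y : S}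
    (hx : x ∈ A) (hy : y ∈ A) : Relation.ReflTransGen (EdgeBelow H q l) x y :=
  (hW.1 x hx y hy).lift id fun u v huv => ⟨huv.1, hl u huv.2.1, hl v huv.2.2⟩

theorem IsWell.exists_exit_path (hW : IsWell H q A) (hb : (extBoundary q A).Nonempty) {x : S}
    (hx : x ∈ A) : ∃ y ∉ A, Relation.ReflTransGen (EdgeBelow H q (exitLevel H q A)) x y := by
  obtain ⟨y, ⟨hyA, a, ha, hay⟩, hyl⟩ := exists_extBoundary_le_exitLevel (H := H) hb
  exact ⟨y, hyA, (hW.reflTransGen_edgeBelow (fun b hb => le_exitLevel hb) hx ha).tail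
    ⟨hay, le_exitLevel ha, hyl⟩⟩
end

theorem tendsto_exp_neg_mul_atTop {c : ℝ} (hc : 0 < c) :
    Filter.Tendsto (fun β : ℝ => Real.exp (-(β * c))) Filter.atTop (nhds 0) :=
  Real.tendsto_exp_neg_atTop_nhds_zero.comp (Filter.tendsto_id.atTop_mul_const hc)

section
variable {H : S → ℝ} {q : S → S → ℝ} {A : Set S} {x : S} {ε : ℝ}

theorem IsWell.tendsto_surv_zero (hW : IsWell H q A) (hq : ∀ x y : S, 0 ≤ q x y)
    (hsum : ∀ x : S, ∑ y ∈ Finset.univ.erase x, q x y ≤ 1) (hsym : ∀ x y : S, q x y = q y x)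
    (hb : (extBoundary q A).Nonempty) (hx : x ∈ A) (hε : 0 < ε) :
    Filter.Tendsto (fun β : ℝ => surv (pMet H q β) A
        (⌈Real.exp (β * (exitLevel H q A - bottom H A + ε))⌉₊ - 1) x)
      Filter.atTop (nhds 0) := by
  obtain ⟨C, hC⟩ := exists_surv_upper_bound hq hsum hsym (fun a ha => bottom_le (H := H) ha)
    (fun z hz => hW.exists_exit_path hb hz)
  refine squeeze_zero' (g := fun β => C * Real.exp (-(β * ε))) ?_ ?_
    (by simpa using (tendsto_exp_neg_mul_atTop hε).const_mul C)
  · filter_upwards [Filter.eventually_ge_atTop 0] with β hβ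
    exact surv_nonneg (pMet_nonneg hq hsum hβ) A _ x
  · filter_upwards [Filter.eventually_ge_atTop 0] with β hβ
    set r := exitLevel H q A - bottom H A
    have h := hC β hβ ⌈Real.exp (β * (r + ε))⌉₊ x hx
    have hs := surv_nonneg (pMet_nonneg (H := H) hq hsum hβ) A (⌈Real.exp (β * (r + ε))⌉₊ - 1) x
    have h2 := (mul_le_mul_of_nonneg_right (Nat.le_ceil _) hs).trans h
    rw [mul_comm, ← le_div_iff₀ (Real.exp_pos _), mul_div_assoc, ← Real.exp_sub] at h2
    refine h2.trans_eq ?_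
    congr 2
    ring

theorem IsWell.tendsto_surv_one (hW : IsWell H q A) (hq : ∀ x y : S, 0 ≤ q x y ∧ q x y ≤ 1)
    (hsum : ∀ x : S, ∑ y ∈ Finset.univ.erase x, q x y ≤ 1) (hsym : ∀ x y : S, q x y = q y x)
    (hb : (extBoundary q A).Nonempty) (hx : x ∈ A) (hε : 0 < ε) :
    Filter.Tendsto (fun β : ℝ => surv (pMet H q β) A
        ⌊Real.exp (β * (exitLevel H q A - bottom H A - ε))⌋₊ x)
      Filter.atTop (nhds 1) := by
  have hA : A.Nonempty := ⟨x, hx⟩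
  rcases (bottom_le_exitLevel (H := H) (q := q) hA).eq_or_lt with he | hlt
  · refine tendsto_const_nhds.congr' ?_
    filter_upwards [Filter.eventually_gt_atTop 0] with β hβ
    have : ⌊Real.exp (β * (exitLevel H q A - bottom H A - ε))⌋₊ = 0 :=
      Nat.floor_eq_zero.2 (Real.exp_lt_one_iff.2 (by nlinarith))
    rw [this, surv_zero]
    simp [hx]
  · have hl := (hW.exitLevel_le_or_eq hA hb).resolve_right hlt.ne'
    obtain ⟨b, hbA, hbot⟩ := exists_eq_bottom (H := H) hA
    obtain ⟨C, hC⟩ := exists_surv_lower_bound hq hsum hsym hbA hl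
      (hW.reflTransGen_edgeBelow (fun a ha => le_sSup_image (H := H) ha) hx hbA)
    rw [hbot] at hC
    set r := exitLevel H q A - bottom H A
    have hs : 0 < (exitLevel H q A - sSup (H '' A)) / 2 :=
      half_pos (sub_pos.2 (hW.sSup_lt_exitLevel hA hb hlt))
    have hlim := ((tendsto_exp_neg_mul_atTop hε).const_mul |C|).add
      ((tendsto_exp_neg_mul_atTop hs).const_mul |C|)
    have hlim' := hlim.const_sub 1
    simp only [mul_zero, add_zero, sub_zero] at hlim'
    refine tendsto_of_tendsto_of_tendsto_of_le_of_le' hlim' tendsto_const_nhds ?_ ?_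
    · filter_upwards [Filter.eventually_ge_atTop 0] with β hβ
      have h := hC β hβ ⌊Real.exp (β * (r - ε))⌋₊
      have hn : (⌊Real.exp (β * (r - ε))⌋₊ : ℝ) * Real.exp (-(β * r)) ≤ Real.exp (-(β * ε)) := by
        refine (mul_le_mul_of_nonneg_right (Nat.floor_le (Real.exp_pos _).le)
          (Real.exp_pos _).le).trans_eq ?_
        rw [← Real.exp_add]
        ring_nf
      have h1 := (mul_le_mul_of_nonneg_right (le_abs_self C) (by positivity)).trans
        (mul_le_mul_of_nonneg_left hn (abs_nonneg C))
      have h2 := mul_le_mul_of_nonneg_right (le_abs_self C)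
        (Real.exp_pos (-(β * ((exitLevel H q A - sSup (H '' A)) / 2)))).le
      linarith
    · filter_upwards [Filter.eventually_ge_atTop 0] with β hβ
      exact surv_le_one (pMet_nonneg (fun x y => (hq x y).1) hsum hβ) (sum_pMet H q β) A _ x
end

/-- Exit time from a graph cycle `A ≠ S`: with probability tending to `1` as `β → ∞`,
`exp(β(H_e(A)+ε)) > τ_{∂A} > exp(β(H_e(A)-ε))`. -/
theorem exitTime_graphCycle (H : S → ℝ) (q : S → S → ℝ)
    (hq : ∀ x y : S, 0 ≤ q x y ∧ q x y ≤ 1)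
    (hsum : ∀ x : S, ∑ y ∈ Finset.univ.erase x, q x y ≤ 1)
    (hsym : ∀ x y : S, q x y = q y x)
    (hirr : ∀ x y : S, JoinedIn q Set.univ x y)
    (A : Set S) (hA : A ∈ GraphCycles H q) (hAS : A ≠ Set.univ) (ε : ℝ) (hε : 0 < ε)
    (x : S) (hx : x ∈ A) :
    Filter.Tendsto (fun β : ℝ =>
        ProbX H q β x ⌈Real.exp (β * ((HeC H q A).toReal + ε))⌉₊ (fun ω =>
          (∃ t : ℕ, hitTime (extBoundary q A) ω = (t : ℕ∞) ∧
              (t : ℝ) < Real.exp (β * ((HeC H q A).toReal + ε))) ∧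
          ∀ t : ℕ, hitTime (extBoundary q A) ω = (t : ℕ∞) →
              Real.exp (β * ((HeC H q A).toReal - ε)) < (t : ℝ)))
      Filter.atTop (nhds 1) := by
  have hq0 : ∀ x y : S, 0 ≤ q x y := fun x y => (hq x y).1
  have hb := extBoundary_nonempty hirr ⟨x, hx⟩ hAS
  have hW : IsWell H q A := by
    obtain ⟨k, hk⟩ := hA
    exact (wellPartition_cycEV H hsym hirr k).isWell A hk
  rw [heC_eq hsym hirr hA hAS,
    ENNReal.toReal_ofReal (sub_nonneg.2 (bottom_le_exitLevel ⟨x, hx⟩))]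
  have hlim := (hW.tendsto_surv_one hq hsum hsym hb hx hε).sub
    (hW.tendsto_surv_zero hq0 hsum hsym hb hx hε)
  rw [sub_zero] at hlim
  refine hlim.congr' ?_
  filter_upwards [Filter.eventually_gt_atTop 0] with β hβ
  exact (probX_exit_window hq0 β hx (Real.exp_pos _).le (Real.exp_lt_exp.2 (by nlinarith))).symm

end MetropolisCycles
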